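/- Let α, β : List (Fin 3) → List (Fin 3) be the states of the transducer A_L. Then α ∘ α = α and α ∘ β = β, and moreover the maps βⁿ (for n ≥ 1) together with the maps βᵐ ∘ α (for m ≥ 0) are pairwise distinct as functions; that is: βᵐ ≠ βⁿ for all 1 ≤ m < n, βᵐ ∘ α ≠ βⁿ ∘ α for all 0 ≤ m < n, and βᵐ ∘ α ≠ βⁿ for all m ≥ 0 and n ≥ 1. (Hence the semigroup generated by α and β has presentation ⟨α, β | α² = α, αβ = β⟩, a free cyclic semigroup generated by β extended by a left identity α.) -/

import Mathlib

/- The states α, β of the 3-to-2 transducer A_L, viewed as maps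
   List (Fin 3) → List (Fin 3). -/
mutual
def alphaL : List (Fin 3) → List (Fin 3)
  | [] => []
  | x :: w => if x = 0 then 0 :: alphaL w else if x = 1 then 1 :: alphaL w else 1 :: betaL w
def betaL : List (Fin 3) → List (Fin 3)
  | [] => []
  | x :: w => if x = 0 then 1 :: alphaL w else if x = 1 then 1 :: betaL w else 0 :: betaL w
end

theorem two_notMem_alphaL_betaL (w : List (Fin 3)) : 2 ∉ alphaL w ∧ 2 ∉ betaL w := by
  induction w with
  | nil => simp [alphaL, betaL]
  | cons x w ih => fin_cases x <;> simp [alphaL, betaL, ih]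

theorem alphaL_of_two_notMem {w : List (Fin 3)} (hw : 2 ∉ w) : alphaL w = w := by
  induction w with
  | nil => simp [alphaL]
  | cons x w ih =>
    rw [List.mem_cons, not_or] at hw
    fin_cases x <;> simp_all [alphaL]

theorem count_zero_betaL {w : List (Fin 3)} (hw : 2 ∉ w) :
    (betaL w).count 0 = w.count 0 - 1 := by
  induction w with
  | nil => simp [betaL]
  | cons x w ih =>
    rw [List.mem_cons, not_or] at hw
    fin_cases x <;> simp_all [betaL, alphaL_of_two_notMem]

theorem count_zero_iterate_betaL (n : ℕ) {w : List (Fin 3)} (hw : 2 ∉ w) :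
    (betaL^[n] w).count 0 = w.count 0 - n := by
  induction n generalizing w with
  | zero => simp
  | succ n ih =>
    rw [Function.iterate_succ_apply, ih (two_notMem_alphaL_betaL w).2, count_zero_betaL hw]
    omega

theorem two_notMem_replicate_zero (k : ℕ) : (2 : Fin 3) ∉ List.replicate k (0 : Fin 3) := by
  simp [List.mem_replicate]

theorem iterate_betaL_replicate_zero_ne {m n : ℕ} (h : m ≠ n) :
    betaL^[m] (List.replicate (m + n) 0) ≠ betaL^[n] (List.replicate (m + n) 0) := by
  intro he
  have hc := congrArg (List.count 0) he
  rw [count_zero_iterate_betaL _ (two_notMem_replicate_zero _),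
    count_zero_iterate_betaL _ (two_notMem_replicate_zero _), List.count_replicate_self] at hc
  omega

theorem iterate_betaL_alphaL_ne {n : ℕ} (hn : 1 ≤ n) :
    betaL^[n] (alphaL (2 :: List.replicate n 0)) ≠ betaL^[n] (2 :: List.replicate n 0) := by
  obtain ⟨k, rfl⟩ := Nat.exists_eq_add_of_le' hn
  intro he
  have hc := congrArg (List.count 0) he
  rw [count_zero_iterate_betaL _ (two_notMem_alphaL_betaL _).1, Function.iterate_succ_apply,
    count_zero_iterate_betaL _ (two_notMem_alphaL_betaL _).2] at hc
  simp [alphaL, betaL, List.replicate_succ,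
    alphaL_of_two_notMem (two_notMem_replicate_zero _)] at hc

/-- The semigroup generated by α and β has presentation
    ⟨α, β ∣ α² = α, αβ = β⟩: the relations hold, and the elements βⁿ (n ≥ 1)
    and βᵐ∘α (m ≥ 0) are pairwise distinct as functions. -/
theorem stmt_0 :
    alphaL ∘ alphaL = alphaL ∧
    alphaL ∘ betaL = betaL ∧
    (∀ m n : ℕ, 1 ≤ m → m < n → betaL^[m] ≠ betaL^[n]) ∧
    (∀ m n : ℕ, m < n → betaL^[m] ∘ alphaL ≠ betaL^[n] ∘ alphaL) ∧
    (∀ m n : ℕ, 1 ≤ n → betaL^[m] ∘ alphaL ≠ betaL^[n]) := by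
  refine ⟨?_, ?_, ?_, ?_, ?_⟩
  · exact funext fun w => alphaL_of_two_notMem (two_notMem_alphaL_betaL w).1
  · exact funext fun w => alphaL_of_two_notMem (two_notMem_alphaL_betaL w).2
  · exact fun m n _ hmn he => iterate_betaL_replicate_zero_ne hmn.ne (congrFun he _)
  · intro m n hmn he
    apply iterate_betaL_replicate_zero_ne hmn.ne
    simpa [alphaL_of_two_notMem (two_notMem_replicate_zero _)] using
      congrFun he (List.replicate (m + n) 0)
  · intro m n hn he
    obtain rfl | hmn := eq_or_ne m n
    · exact iterate_betaL_alphaL_ne hn (congrFun he _)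
    · apply iterate_betaL_replicate_zero_ne hmn
      simpa [alphaL_of_two_notMem (two_notMem_replicate_zero _)] using
        congrFun he (List.replicate (m + n) 0)
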